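/- The group E₂(ℒ), where ℒ is the ring of Lipschitz quaternions, is a nontrivial free product with amalgamation; that is, there exist groups A, B, C, injective group homomorphisms f : C → A and g : C → B, neither of which is surjective, and a group isomorphism between E₂(ℒ) and the amalgamated free product A ∗_C B (the pushout of f and g). -/

import Mathlib

universe u v w

/-- A two-element family of types indexed by `Bool`. -/
def boolFam (A B : Type u) : Bool → Type u := fun b => match b with
  | true => A
  | false => B

instance boolFamGroup {A B : Type u} [Group A] [Group B] : ∀ b, Group (boolFam A B b)
  | true => inferInstanceAs (Group A)
  | false => inferInstanceAs (Group B)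

/-- The pair of maps `f : C →* A`, `g : C →* B` as a `Bool`-indexed family. -/
def boolHoms {A B C : Type u} [Group A] [Group B] [Group C] (f : C →* A) (g : C →* B) :
    (b : Bool) → C →* boolFam A B b
  | true => f
  | false => g

/-- A group `Γ` is a nontrivial free product with amalgamation if it is isomorphic to the
pushout (amalgamated free product) `A ∗_C B` of two injective, non-surjective group
homomorphisms `f : C → A` and `g : C → B`. -/
def IsNontrivialAmalgam (Γ : Type v) [Group Γ] : Prop :=
  ∃ (A B C : Type v) (_ : Group A) (_ : Group B) (_ : Group C)
    (f : C →* A) (g : C →* B),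
      Function.Injective f ∧ Function.Injective g ∧
      ¬ Function.Surjective f ∧ ¬ Function.Surjective g ∧
      Nonempty (Γ ≃* Monoid.PushoutI (boolHoms f g))

noncomputable section

/-- The elementary unit `E(x)` over a ring `R`. -/
def Em (R : Type*) [Ring R] (x : R) : (Matrix (Fin 2) (Fin 2) R)ˣ where
  val := !![x, 1; -1, 0]
  inv := !![0, -1; 1, x]
  val_inv := by
    ext i j
    fin_cases i <;> fin_cases j <;>
      simp [Matrix.mul_apply, Fin.sum_univ_two, Matrix.one_apply]
  inv_val := by
    ext i j
    fin_cases i <;> fin_cases j <;>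
      simp [Matrix.mul_apply, Fin.sum_univ_two, Matrix.one_apply]

/-- The group `E₂(R)` generated by the elementary matrices `E(x)`, `x ∈ R`. -/
def E2 (R : Type*) [Ring R] : Subgroup (Matrix (Fin 2) (Fin 2) R)ˣ :=
  Subgroup.closure (Set.range (Em R))

open Monoid

section Recognition

variable {G : Type*} [Group G]

/-- The canonical map from the amalgamated product of two subgroups, over their intersection, to
the ambient group. -/
def amalgamToGroup (A B : Subgroup G) :
    PushoutI (boolHoms (Subgroup.inclusion (inf_le_left : A ⊓ B ≤ A))
      (Subgroup.inclusion (inf_le_right : A ⊓ B ≤ B))) →* G :=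
  PushoutI.lift (fun b => match b with
    | true => A.subtype
    | false => B.subtype) (A ⊓ B).subtype (by rintro (_ | _) <;> rfl)

variable {A B : Subgroup G}

theorem amalgamToGroup_of_true (a : boolFam A B true) :
    amalgamToGroup A B (PushoutI.of true a) = Subtype.val (show A from a) :=
  PushoutI.lift_of _ _ _ _

theorem amalgamToGroup_of_false (b : boolFam A B false) :
    amalgamToGroup A B (PushoutI.of false b) = Subtype.val (show B from b) :=
  PushoutI.lift_of _ _ _ _

theorem amalgamToGroup_base (c : ↥(A ⊓ B)) :
    amalgamToGroup A B (PushoutI.base _ c) = c := by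
  simp only [amalgamToGroup, PushoutI.lift_base]; rfl

theorem amalgamToGroup_surjective (hAB : A ⊔ B = ⊤) :
    Function.Surjective (amalgamToGroup A B) := by
  rw [← MonoidHom.range_eq_top, eq_top_iff, ← hAB, sup_le_iff]
  exact ⟨fun a ha => ⟨PushoutI.of (G := boolFam A B) true (⟨a, ha⟩ : A), amalgamToGroup_of_true _⟩,
    fun b hb => ⟨PushoutI.of (G := boolFam A B) false (⟨b, hb⟩ : B), amalgamToGroup_of_false _⟩⟩

theorem word_eq_empty {M : Bool → Type*} [∀ i, Monoid (M i)] {w : CoprodI.Word M}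
    (ht : w.fstIdx ≠ some true) (hf : w.fstIdx ≠ some false) : w = CoprodI.Word.empty := by
  ext1
  rcases h : w.toList with _ | ⟨⟨_ | _, x⟩, l⟩
  · rfl
  · simp [CoprodI.Word.fstIdx, h] at hf
  · simp [CoprodI.Word.fstIdx, h] at ht

/-- Ping-pong position of a reduced word, according to the factor of its first letter. -/
theorem amalgamToGroup_word_mem_iff {S : Set G} (hBS : ∀ b ∈ B, b ∈ S)
    (hA : ∀ a ∈ A, a ∉ B → ∀ g ∈ S, a * g ∉ S)
    (hB : ∀ b ∈ B, b ∉ A → ∀ g, g ∉ S → b * g ∈ S)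
    (w : CoprodI.Word (boolFam A B))
    (hw : PushoutI.Reduced (boolHoms (Subgroup.inclusion (inf_le_left : A ⊓ B ≤ A))
      (Subgroup.inclusion (inf_le_right : A ⊓ B ≤ B))) w) :
    amalgamToGroup A B (PushoutI.ofCoprodI w.prod) ∈ S ↔ w.fstIdx ≠ some true := by
  induction w using CoprodI.Word.consRecOn with
  | empty => simpa [CoprodI.Word.fstIdx] using hBS 1 B.one_mem
  | cons i g w hIdx hg1 ih =>
    have ih := ih fun _ hg => hw _ (List.mem_cons_of_mem _ hg)
    have hg := hw ⟨i, g⟩ List.mem_cons_self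
    simp only [CoprodI.Word.prod_cons, map_mul, PushoutI.ofCoprodI_of]
    cases i with
    | true =>
      have hgB : (g : A).1 ∉ B := fun h => hg ⟨⟨_, (g : A).2, h⟩, rfl⟩
      rw [amalgamToGroup_of_true]
      simpa [CoprodI.Word.fstIdx, CoprodI.Word.cons] using hA _ (g : A).2 hgB _ (ih.2 hIdx)
    | false =>
      have hgA : (g : B).1 ∉ A := fun h => hg ⟨⟨_, h, (g : B).2⟩, rfl⟩
      rw [amalgamToGroup_of_false]
      simp only [CoprodI.Word.fstIdx, CoprodI.Word.cons, List.head?_cons, Option.map_some, ne_eq,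
        Option.some.injEq, Bool.false_eq_true, not_false_eq_true, iff_true]
      by_cases hS : amalgamToGroup A B (PushoutI.ofCoprodI w.prod) ∈ S
      · have hne := ih.1 hS
        obtain rfl := word_eq_empty hne hIdx
        simpa using hBS _ (g : B).2
      · exact hB _ (g : B).2 hgA _ hS

theorem amalgamToGroup_injective {S : Set G} (hBS : ∀ b ∈ B, b ∈ S)
    (hA : ∀ a ∈ A, a ∉ B → ∀ g ∈ S, a * g ∉ S)
    (hB : ∀ b ∈ B, b ∉ A → ∀ g, g ∉ S → b * g ∈ S) :
    Function.Injective (amalgamToGroup A B) := by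
  classical
  let φ := boolHoms (Subgroup.inclusion (inf_le_left : A ⊓ B ≤ A))
    (Subgroup.inclusion (inf_le_right : A ⊓ B ≤ B))
  have hinj : ∀ i, Function.Injective (φ i) := by
    rintro (_ | _)
    exacts [Subgroup.inclusion_injective inf_le_right, Subgroup.inclusion_injective inf_le_left]
  obtain ⟨d⟩ := PushoutI.NormalWord.transversal_nonempty φ hinj
  rw [injective_iff_map_eq_one]
  intro x hx
  obtain ⟨w, rfl⟩ := (PushoutI.NormalWord.equiv (d := d)).symm.surjective x
  obtain ⟨w, h, hn⟩ := w
  change amalgamToGroup A B (PushoutI.base φ h * PushoutI.ofCoprodI w.prod) = 1 at hx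
  change PushoutI.base φ h * PushoutI.ofCoprodI w.prod = 1
  have hred : PushoutI.Reduced φ w := by
    intro g hg hr
    have := (d.compl g.1).1 (a₁ := (⟨g.2, hr⟩, ⟨1, d.one_mem _⟩))
      (a₂ := (⟨1, one_mem _⟩, ⟨g.2, hn _ _ hg⟩)) (by simp)
    simp only [Prod.mk.injEq, Subtype.mk.injEq] at this
    exact w.ne_one g hg this.1
  rw [map_mul, amalgamToGroup_base, mul_eq_one_iff_inv_eq] at hx
  have hS := amalgamToGroup_word_mem_iff hBS hA hB
  induction w using CoprodI.Word.consRecOn with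
  | empty =>
    have : h = 1 := by simpa using hx
    simp [this]
  | cons i g w hIdx hg1 ih =>
    exfalso
    have hw : PushoutI.Reduced φ w := fun _ hg => hred _ (List.mem_cons_of_mem _ hg)
    have hg := hred ⟨i, g⟩ List.mem_cons_self
    have hmem := hS _ hred
    rw [← hx] at hmem
    cases i with
    | true => exact hmem.1 (hBS _ (B.inv_mem h.2.2)) rfl
    | false =>
      have hgA : (g : B).1 ∉ A := fun h => hg ⟨⟨_, h, (g : B).2⟩, rfl⟩
      simp only [CoprodI.Word.prod_cons, map_mul, PushoutI.ofCoprodI_of] at hx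
      rw [amalgamToGroup_of_false] at hx
      have hwB : amalgamToGroup A B (PushoutI.ofCoprodI w.prod) ∈ B := by
        rw [← inv_mul_eq_iff_eq_mul] at hx
        rw [← hx]
        exact B.mul_mem (B.inv_mem (g : B).2) (B.inv_mem h.2.2)
      have hne := (hS _ hw).1 (hBS _ hwB)
      obtain rfl := word_eq_empty hne hIdx
      simp only [CoprodI.Word.prod_empty, map_one, mul_one] at hx
      exact hgA (hx ▸ A.inv_mem h.2.1)

/-- A ping-pong criterion for a group to be a nontrivial amalgam of two subgroups. -/
theorem isNontrivialAmalgam_of_pingPong {S : Set G} (hAB : A ⊔ B = ⊤)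
    (hnA : ¬ A ≤ B) (hnB : ¬ B ≤ A) (hBS : ∀ b ∈ B, b ∈ S)
    (hA : ∀ a ∈ A, a ∉ B → ∀ g ∈ S, a * g ∉ S)
    (hB : ∀ b ∈ B, b ∉ A → ∀ g, g ∉ S → b * g ∈ S) :
    IsNontrivialAmalgam G := by
  refine ⟨A, B, ↥(A ⊓ B), inferInstance, inferInstance, inferInstance,
    Subgroup.inclusion inf_le_left, Subgroup.inclusion inf_le_right,
    Subgroup.inclusion_injective _, Subgroup.inclusion_injective _, fun h => hnA fun a ha => ?_,
    fun h => hnB fun b hb => ?_, ⟨(MulEquiv.ofBijective (amalgamToGroup A B)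
      ⟨amalgamToGroup_injective hBS hA hB, amalgamToGroup_surjective hAB⟩).symm⟩⟩
  · obtain ⟨c, hc⟩ := h ⟨a, ha⟩
    have hca : (c : G) = a := congrArg Subtype.val hc
    exact hca ▸ c.2.2
  · obtain ⟨c, hc⟩ := h ⟨b, hb⟩
    have hcb : (c : G) = b := congrArg Subtype.val hc
    exact hcb ▸ c.2.1

end Recognition

section HalfSpaces

variable {G X : Type*} [Group G] [AddCommGroup X] (ρ : G →* AddMonoid.End X)

theorem map_mul_apply (g h : G) (x : X) : ρ (g * h) x = ρ g (ρ h x) := by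
  rw [map_mul]; rfl

theorem map_inv_apply_eq_iff (g : G) (x y : X) : ρ g⁻¹ x = y ↔ x = ρ g y := by
  constructor
  · rintro rfl
    rw [← map_mul_apply]; simp
  · rintro rfl
    rw [← map_mul_apply]; simp

/-- The stabilizer of a vector up to sign. -/
def signStabilizer (v : X) : Subgroup G where
  carrier := {g | ρ g v = v ∨ ρ g v = -v}
  one_mem' := by simp
  mul_mem' := by
    rintro a b (ha | ha) (hb | hb) <;> simp [ha, hb]
  inv_mem' := by
    rintro a (ha | ha)
    · left; rw [map_inv_apply_eq_iff, ha]
    · right; rw [map_inv_apply_eq_iff, map_neg, ha, neg_neg]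

/-- The elements of `G` acting on the `G`-stable set `H` compatibly with the sign of `ℓ`. -/
def chamberStabilizer (ℓ : X →+ ℤ) (H : Set X) (hH : ∀ g, ∀ x ∈ H, ρ g x ∈ H) : Subgroup G where
  carrier := {g | ∀ x ∈ H, 0 < ℓ (ρ g x) ↔ 0 < ℓ x}
  one_mem' := by simp
  mul_mem' := by
    intro a b ha hb x hx
    simp only [map_mul_apply]
    rw [ha _ (hH _ _ hx), hb _ hx]
  inv_mem' := by
    intro a ha x hx
    rw [← ha _ (hH _ _ hx), ← (map_inv_apply_eq_iff ρ a x _).1 rfl]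

/-- Let `G` act on a set `H` of oriented half-spaces, ordered by the cone `K`, in which any two are
nested up to complements. If `v` is minimal among the half-spaces on which `ℓ` is positive, then
`G` is an amalgam of the stabilizer of the wall `v` and of the stabilizer of the chamber `ℓ`,
provided these generate `G` and neither contains the other. -/
theorem isNontrivialAmalgam_of_nested {K H : Set X} {ℓ : X →+ ℤ} {v : X}
    (hK : ∀ g, ∀ x ∈ K, ρ g x ∈ K) (hH : ∀ g, ∀ x ∈ H, ρ g x ∈ H) (hneg : ∀ x ∈ H, -x ∈ H)
    (hnest : ∀ x ∈ H, ∀ y ∈ H, y - x ∈ K ∨ x - y ∈ K ∨ x + y ∈ K ∨ -(x + y) ∈ K)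
    (hℓK : ∀ x ∈ K, 0 ≤ ℓ x) (hℓH : ∀ x ∈ H, ℓ x ≠ 0) (hv : v ∈ H) (hℓv : 0 < ℓ v)
    (hmin : ∀ x ∈ H, 0 < ℓ x → v - x ∈ K → x = v)
    (hgen : signStabilizer ρ v ⊔ chamberStabilizer ρ ℓ H hH = ⊤)
    (hflip : ∃ g, ρ g v = -v) (hmove : ¬ chamberStabilizer ρ ℓ H hH ≤ signStabilizer ρ v) :
    IsNontrivialAmalgam G := by
  have hfix : ∀ c, ρ c v = v → ∀ x ∈ H, 0 < ℓ x → 0 < ℓ (ρ c x) := by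
    intro c hc x hx hpos
    rcases hnest x hx v hv with h | h | h | h
    · rwa [hmin x hx hpos h, hc]
    · have := hℓK _ (hK c _ h)
      rw [map_sub, map_sub, hc] at this
      linarith
    · by_contra hcon
      have hlt : ℓ (ρ c x) < 0 := lt_of_le_of_ne (not_lt.1 hcon) (hℓH _ (hH c x hx))
      have h1 := hmin _ (hneg _ (hH c x hx)) (by rw [map_neg]; linarith) (by
        have := hK c _ h
        rwa [map_add, hc, add_comm, ← sub_neg_eq_add] at this)
      have h2 : x = -v := by
        rw [← map_neg] at h1
        rw [← neg_eq_iff_eq_neg, ← (map_inv_apply_eq_iff ρ c v _).2 h1.symm,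
          map_inv_apply_eq_iff, hc]
      rw [h2, map_neg] at hpos
      linarith
    · have := hℓK _ h
      rw [map_neg, map_add] at this
      linarith
  have hCB : ∀ c, ρ c v = v → c ∈ chamberStabilizer ρ ℓ H hH := by
    intro c hc x hx
    refine ⟨fun h => ?_, hfix c hc x hx⟩
    have := hfix c⁻¹ ((map_inv_apply_eq_iff ρ _ _ _).2 hc.symm) _ (hH c x hx) h
    rwa [(map_inv_apply_eq_iff ρ c _ x).2 rfl] at this
  refine isNontrivialAmalgam_of_pingPong (S := {g | 0 < ℓ (ρ g⁻¹ v)}) hgen ?_ hmove ?_ ?_ ?_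
  · obtain ⟨g, hg⟩ := hflip
    intro hle
    have := (hle (Or.inr hg : g ∈ signStabilizer ρ v) v hv).2 hℓv
    rw [hg, map_neg] at this
    linarith
  · intro b hb
    exact (inv_mem hb v hv).2 hℓv
  · intro a ha haB g hg
    have hav : ρ a v = -v := ha.resolve_left fun h => haB (hCB a h)
    have hav' : ρ a⁻¹ v = -v := by rw [map_inv_apply_eq_iff, map_neg, hav, neg_neg]
    simp only [Set.mem_ofPred_eq] at hg
    simp only [Set.mem_ofPred_eq, mul_inv_rev, map_mul_apply, hav', map_neg]
    linarith
  · intro b hb hbA g hg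
    simp only [Set.mem_ofPred_eq, mul_inv_rev, map_mul_apply] at hg ⊢
    have huH := hH b⁻¹ v hv
    have hu : 0 < ℓ (ρ b⁻¹ v) := (inv_mem hb v hv).2 hℓv
    have hne : ρ b v ≠ v := fun h => hbA (Or.inl h)
    have hbu : ρ b (ρ b⁻¹ v) = v := ((map_inv_apply_eq_iff ρ b v _).1 rfl).symm
    rcases hnest _ huH v hv with h | h | h | h
    · exact absurd ((map_inv_apply_eq_iff ρ _ _ _).1 (hmin _ huH hu h)).symm hne
    · have := hK b _ h
      rw [map_sub, hbu] at this
      exact absurd (hmin _ (hH b v hv) ((hb v hv).2 hℓv) this) hne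
    · have := hℓK _ (hK g⁻¹ _ h)
      rw [map_add, map_add] at this
      exact lt_of_le_of_ne (by linarith) (hℓH _ (hH _ _ huH)).symm
    · have := hℓK _ h
      rw [map_neg, map_add] at this
      linarith

end HalfSpaces

section Action

variable {R : Type*} [Ring R]

/-- The action of invertible matrices on Hermitian forms, `g • X = g * X * gᴴ`. -/
def hermitianAction [StarRing R] :
    (Matrix (Fin 2) (Fin 2) R)ˣ →* AddMonoid.End (Matrix (Fin 2) (Fin 2) R) where
  toFun g :=
    { toFun := fun X => g.val * X * g.val.conjTranspose
      map_zero' := by simp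
      map_add' := by intro X Y; rw [mul_add, add_mul] }
  map_one' := by ext1 X; simp; rfl
  map_mul' g h := by
    ext1 X
    change (g * h : (Matrix (Fin 2) (Fin 2) R)ˣ).val * X * _ =
      g.val * (h.val * X * h.val.conjTranspose) * g.val.conjTranspose
    simp only [Units.val_mul, Matrix.conjTranspose_mul, mul_assoc]

theorem Em_mul_inv_mul (x y : R) : Em R x * (Em R 0)⁻¹ * Em R y = Em R (x + y) := by
  ext i j
  fin_cases i <;> fin_cases j <;> simp [Em, Matrix.mul_apply, Fin.sum_univ_two, add_comm]

theorem Em_inv (x : R) : (Em R x)⁻¹ = Em R 0 * Em R (-x) * Em R 0 := by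
  rw [inv_eq_iff_mul_eq_one]
  ext i j
  fin_cases i <;> fin_cases j <;> simp [Em, Matrix.mul_apply, Fin.sum_univ_two]

theorem E2_induction {p : (Matrix (Fin 2) (Fin 2) R)ˣ → Prop} (hp : ∀ x, p (Em R x))
    (hone : p 1) (hmul : ∀ g h, p g → p h → p (g * h)) {g : (Matrix (Fin 2) (Fin 2) R)ˣ}
    (hg : g ∈ E2 R) : p g := by
  suffices p g ∧ p g⁻¹ from this.1
  induction hg using Subgroup.closure_induction with
  | mem g hg =>
    obtain ⟨x, rfl⟩ := hg
    exact ⟨hp x, Em_inv x ▸ hmul _ _ (hmul _ _ (hp 0) (hp (-x))) (hp 0)⟩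
  | one => simpa using hone
  | mul g h _ _ ihg ihh =>
    exact ⟨hmul _ _ ihg.1 ihh.1, mul_inv_rev g h ▸ hmul _ _ ihh.2 ihg.2⟩
  | inv g _ ih => exact ⟨ih.2, (inv_inv g).symm ▸ ih.1⟩

/-- A set of Hermitian forms stable under all `E(x)` is stable under `E₂(R)`. -/
theorem hermitianAction_mem [StarRing R] {T : Set (Matrix (Fin 2) (Fin 2) R)}
    (hT : ∀ x, ∀ X ∈ T, hermitianAction (Em R x) X ∈ T) {g : (Matrix (Fin 2) (Fin 2) R)ˣ}
    (hg : g ∈ E2 R) : ∀ X ∈ T, hermitianAction g X ∈ T := by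
  refine E2_induction (p := fun g => ∀ X ∈ T, hermitianAction g X ∈ T) hT (by simp) ?_ hg
  intro g h hg hh X hX
  rw [map_mul_apply]
  exact hg _ (hh X hX)

end Action

section Lipschitz

/-- The Lipschitz quaternion `p + q i + r j + s k`. -/
@[simps]
def lipschitz (p q r s : ℤ) : Quaternion ℤ := ⟨p, q, r, s⟩

/-- The Hermitian matrix with diagonal `a`, `d` and upper right entry `p + q i + r j + s k`. -/
def herm (a d p q r s : ℤ) : Matrix (Fin 2) (Fin 2) (Quaternion ℤ) :=
  !![lipschitz a 0 0 0, lipschitz p q r s; lipschitz p (-q) (-r) (-s), lipschitz d 0 0 0]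

theorem herm_add (a d p q r s a' d' p' q' r' s' : ℤ) :
    herm a d p q r s + herm a' d' p' q' r' s' =
      herm (a + a') (d + d') (p + p') (q + q') (r + r') (s + s') := by
  ext i j <;> fin_cases i <;> fin_cases j <;> simp [herm] <;> ring

theorem herm_neg (a d p q r s : ℤ) :
    -herm a d p q r s = herm (-a) (-d) (-p) (-q) (-r) (-s) := by
  ext i j <;> fin_cases i <;> fin_cases j <;> simp [herm]

theorem herm_sub (a d p q r s a' d' p' q' r' s' : ℤ) :
    herm a d p q r s - herm a' d' p' q' r' s' =
      herm (a - a') (d - d') (p - p') (q - q') (r - r') (s - s') := by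
  rw [sub_eq_add_neg, herm_neg, herm_add]; simp only [sub_eq_add_neg]

theorem hermitianAction_Em_herm (x : Quaternion ℤ) (a d p q r s : ℤ) :
    hermitianAction (Em _ x) (herm a d p q r s) =
      herm (a * (x.re ^ 2 + x.imI ^ 2 + x.imJ ^ 2 + x.imK ^ 2) +
          2 * (x.re * p - x.imI * q - x.imJ * r - x.imK * s) + d) a
        (-(a * x.re) - p) (-(a * x.imI) + q) (-(a * x.imJ) + r) (-(a * x.imK) + s) := by
  change !![x, 1; -1, 0] * herm a d p q r s * (!![x, 1; -1, 0]).conjTranspose = _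
  ext i j <;> fin_cases i <;> fin_cases j <;>
    simp [herm, Matrix.mul_apply, Fin.sum_univ_two] <;> ring

/-- Positive semidefinite integral Hermitian matrices. -/
def posCone : Set (Matrix (Fin 2) (Fin 2) (Quaternion ℤ)) :=
  {X | ∃ a d p q r s : ℤ, X = herm a d p q r s ∧ 0 ≤ a ∧ 0 ≤ d ∧
    p ^ 2 + q ^ 2 + r ^ 2 + s ^ 2 ≤ a * d}

/-- The Hermitian matrices of determinant `-1` congruent to `!![0, 1; 1, 0]` modulo `2`. -/
def halfSpaces : Set (Matrix (Fin 2) (Fin 2) (Quaternion ℤ)) :=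
  {X | ∃ a d p q r s : ℤ, X = herm (2 * a) (2 * d) (2 * p + 1) (2 * q) (2 * r) (2 * s) ∧
    (2 * p + 1) ^ 2 + (2 * q) ^ 2 + (2 * r) ^ 2 + (2 * s) ^ 2 - 2 * a * (2 * d) = 1}

/-- Pairing with a positive definite Hermitian form. -/
def chamberForm : Matrix (Fin 2) (Fin 2) (Quaternion ℤ) →+ ℤ where
  toFun X := (X 0 0).re + (X 1 1).re + (X 0 1).re
  map_zero' := rfl
  map_add' X Y := by simp; ring

theorem chamberForm_herm (a d p q r s : ℤ) : chamberForm (herm a d p q r s) = a + d + p :=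
  rfl

theorem hermitianAction_Em_mem_posCone (x : Quaternion ℤ) :
    ∀ X ∈ posCone, hermitianAction (Em _ x) X ∈ posCone := by
  rintro _ ⟨a, d, p, q, r, s, rfl, ha, hd, h⟩
  rw [hermitianAction_Em_herm]
  refine ⟨_, _, _, _, _, _, rfl, ?_, ha, by linarith⟩
  rcases ha.eq_or_lt with rfl | ha
  · have hp : p = 0 := by nlinarith
    have hq : q = 0 := by nlinarith
    have hr : r = 0 := by nlinarith
    have hs : s = 0 := by nlinarith
    simpa [hp, hq, hr, hs] using hd
  · refine nonneg_of_mul_nonneg_right (a := a) ?_ ha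
    linarith [sq_nonneg (a * x.re + p), sq_nonneg (a * x.imI - q), sq_nonneg (a * x.imJ - r),
      sq_nonneg (a * x.imK - s)]

theorem hermitianAction_Em_mem_halfSpaces (x : Quaternion ℤ) :
    ∀ X ∈ halfSpaces, hermitianAction (Em _ x) X ∈ halfSpaces := by
  rintro _ ⟨a, d, p, q, r, s, rfl, h⟩
  rw [hermitianAction_Em_herm]
  refine ⟨a * (x.re ^ 2 + x.imI ^ 2 + x.imJ ^ 2 + x.imK ^ 2) +
    (x.re * (2 * p + 1) - x.imI * (2 * q) - x.imJ * (2 * r) - x.imK * (2 * s)) + d, a,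
    -(a * x.re) - p - 1, -(a * x.imI) + q, -(a * x.imJ) + r, -(a * x.imK) + s, ?_, ?_⟩
  · congr 1 <;> ring
  · linarith

theorem neg_mem_halfSpaces : ∀ X ∈ halfSpaces, -X ∈ halfSpaces := by
  rintro _ ⟨a, d, p, q, r, s, rfl, h⟩
  refine ⟨-a, -d, -p - 1, -q, -r, -s, ?_, by linarith⟩
  rw [herm_neg]
  congr 1 <;> ring

theorem herm_mem_posCone_or_neg {a d p q r s : ℤ}
    (h : p ^ 2 + q ^ 2 + r ^ 2 + s ^ 2 ≤ a * d) :
    herm a d p q r s ∈ posCone ∨ -herm a d p q r s ∈ posCone := by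
  have had : 0 ≤ a * d := le_trans (by positivity) h
  rcases mul_nonneg_iff.1 had with ⟨ha, hd⟩ | ⟨ha, hd⟩
  · exact Or.inl ⟨_, _, _, _, _, _, rfl, ha, hd, h⟩
  · exact Or.inr ⟨_, _, _, _, _, _, herm_neg .., by linarith, by linarith, by linarith⟩

theorem halfSpaces_nested : ∀ X ∈ halfSpaces, ∀ Y ∈ halfSpaces,
    Y - X ∈ posCone ∨ X - Y ∈ posCone ∨ X + Y ∈ posCone ∨ -(X + Y) ∈ posCone := by
  rintro _ ⟨a, d, p, q, r, s, rfl, h⟩ _ ⟨a', d', p', q', r', s', rfl, h'⟩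
  rw [← neg_sub (herm (2 * a') _ _ _ _ _), herm_sub, herm_add, ← or_assoc]
  obtain ⟨t, ht⟩ : ∃ t : ℤ, (2 * p + 1) * (2 * p' + 1) + 2 * q * (2 * q') + 2 * r * (2 * r') +
      2 * s * (2 * s') - 2 * (a * d' + a' * d) = 2 * t + 1 :=
    ⟨2 * p * p' + p + p' + 2 * q * q' + 2 * r * r' + 2 * s * s' - (a * d' + a' * d), by ring⟩
  rcases le_or_gt 0 t with h0 | h0
  · exact Or.inl (herm_mem_posCone_or_neg (by linarith))
  · exact Or.inr (herm_mem_posCone_or_neg (by linarith [Int.add_one_le_iff.2 h0]))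

theorem eq_zero_of_mem_posCone {X : Matrix (Fin 2) (Fin 2) (Quaternion ℤ)} (hX : X ∈ posCone)
    (h0 : chamberForm X ≤ 0) : X = 0 := by
  obtain ⟨a, d, p, q, r, s, rfl, ha, hd, h⟩ := hX
  rw [chamberForm_herm] at h0
  have hsq : (a + d) ^ 2 ≤ p ^ 2 := by nlinarith
  have ha0 : a = 0 := by nlinarith [sq_nonneg q, sq_nonneg r, sq_nonneg s]
  have hd0 : d = 0 := by nlinarith [sq_nonneg q, sq_nonneg r, sq_nonneg s]
  subst ha0 hd0
  have hp : p = 0 := by nlinarith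
  have hq : q = 0 := by nlinarith
  have hr : r = 0 := by nlinarith
  have hs : s = 0 := by nlinarith
  subst hp hq hr hs
  ext i j <;> fin_cases i <;> fin_cases j <;> rfl

theorem chamberForm_nonneg : ∀ X ∈ posCone, 0 ≤ chamberForm X := by
  intro X hX
  by_contra! hlt
  simp [eq_zero_of_mem_posCone hX hlt.le] at hlt

theorem chamberForm_ne_zero : ∀ X ∈ halfSpaces, chamberForm X ≠ 0 := by
  rintro _ ⟨a, d, p, q, r, s, rfl, h⟩
  rw [chamberForm_herm]
  omega

/-- A subgroup containing `E(1)` and all `E(x)` with `x` purely imaginary contains all `E(x)`. -/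
theorem Em_mem_of_im_mem {Γ : Subgroup (Matrix (Fin 2) (Fin 2) (Quaternion ℤ))ˣ}
    (h1 : Em _ 1 ∈ Γ) (him : ∀ x : Quaternion ℤ, x.re = 0 → Em _ x ∈ Γ) (x : Quaternion ℤ) :
    Em _ x ∈ Γ := by
  have h0 : Em _ 0 ∈ Γ := him 0 rfl
  have hadd : ∀ x y : Quaternion ℤ, Em _ x ∈ Γ → Em _ y ∈ Γ → Em _ (x + y) ∈ Γ := fun x y hx hy =>
    Em_mul_inv_mul x y ▸ mul_mem (mul_mem hx (inv_mem h0)) hy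
  have hneg : ∀ x : Quaternion ℤ, Em _ x ∈ Γ → Em _ (-x) ∈ Γ := by
    intro x hx
    have h := mul_mem (mul_mem (inv_mem h0) (inv_mem hx)) (inv_mem h0)
    rwa [Em_inv x, show (Em _ 0)⁻¹ * (Em _ 0 * Em _ (-x) * Em _ 0) * (Em _ 0)⁻¹ = Em _ (-x) by
      group] at h
  let N : AddSubgroup (Quaternion ℤ) :=
    { carrier := {x | Em _ x ∈ Γ}
      zero_mem' := h0
      add_mem' := fun {x y} hx hy => hadd x y hx hy
      neg_mem' := fun {x} hx => hneg x hx }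
  have hx : x = x.re • (1 : Quaternion ℤ) + x.im := by ext <;> simp
  rw [hx]
  exact N.add_mem (N.zsmul_mem h1 _) (him _ (by simp))

end Lipschitz

/-- `E₂(ℒ)`, `ℒ` the Lipschitz quaternions, is a nontrivial free product with amalgamation. -/
theorem E2_lipschitz_isNontrivialAmalgam : IsNontrivialAmalgam ↥(E2 (Quaternion ℤ)) := by
  have hH : ∀ g : E2 (Quaternion ℤ), ∀ X ∈ halfSpaces,
      hermitianAction.comp (E2 _).subtype g X ∈ halfSpaces :=
    fun g => hermitianAction_mem hermitianAction_Em_mem_halfSpaces g.2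
  have hEm : ∀ x : Quaternion ℤ, Em _ x ∈ E2 (Quaternion ℤ) :=
    fun x => Subgroup.subset_closure ⟨x, rfl⟩
  have hv : herm 0 0 1 0 0 0 ∈ halfSpaces := ⟨0, 0, 0, 0, 0, 0, by simp, by simp⟩
  have hflip : ∀ x : Quaternion ℤ, x.re = 0 →
      hermitianAction (Em _ x) (herm 0 0 1 0 0 0) = -herm 0 0 1 0 0 0 := by
    intro x hx
    rw [hermitianAction_Em_herm, herm_neg]
    simp [hx]
  have hone : (1 : Quaternion ℤ).re = 1 ∧ (1 : Quaternion ℤ).imI = 0 ∧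
      (1 : Quaternion ℤ).imJ = 0 ∧ (1 : Quaternion ℤ).imK = 0 := ⟨rfl, rfl, rfl, rfl⟩
  have hrot : (⟨Em _ 1, hEm 1⟩ : E2 (Quaternion ℤ)) ∈
      chamberStabilizer (hermitianAction.comp (E2 _).subtype) chamberForm halfSpaces hH := by
    rintro _ ⟨a, d, p, q, r, s, rfl, h⟩
    change 0 < chamberForm (hermitianAction (Em _ 1) _) ↔ _
    rw [hermitianAction_Em_herm, chamberForm_herm, chamberForm_herm, hone.1, hone.2.1, hone.2.2.1,
      hone.2.2.2]
    ring_nf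
  refine isNontrivialAmalgam_of_nested (hermitianAction.comp (E2 (Quaternion ℤ)).subtype)
    (fun g => hermitianAction_mem hermitianAction_Em_mem_posCone g.2) hH neg_mem_halfSpaces
    halfSpaces_nested chamberForm_nonneg chamberForm_ne_zero hv (by simp [chamberForm_herm])
    ?_ ?_ ⟨⟨Em _ 0, hEm 0⟩, hflip 0 rfl⟩ fun hle => ?_
  · intro X hX hpos hcone
    refine (sub_eq_zero.1 (eq_zero_of_mem_posCone hcone ?_)).symm
    rw [map_sub, chamberForm_herm]
    linarith [Int.add_one_le_iff.2 hpos]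
  · rw [eq_top_iff, ← Subgroup.map_le_map_iff_of_injective (E2 _).subtype_injective,
      ← MonoidHom.range_eq_map, Subgroup.range_subtype]
    refine (Subgroup.closure_le _).2 ?_
    rintro _ ⟨x, rfl⟩
    refine Em_mem_of_im_mem ?_ (fun y hy => ?_) x
    · exact ⟨_, Subgroup.mem_sup_right hrot, rfl⟩
    · exact ⟨⟨Em _ y, hEm y⟩, Subgroup.mem_sup_left (Or.inr (hflip y hy)), rfl⟩
  · have h := hle hrot
    change hermitianAction (Em _ 1) _ = _ ∨ hermitianAction (Em _ 1) _ = _ at h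
    rw [hermitianAction_Em_herm, herm_neg, hone.1] at h
    rcases h with h | h
    all_goals simpa [herm] using congrArg (fun X => (X 0 0).re) h
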